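/- arXiv:0808.1037 — 6 statements merged into one kernel-verified Lean document; each statement's English description precedes it below -/
import Mathlib

section
/- For the basis structure (δ_Z, ε_Z) on IV = Fin 4 in FRel: a state φ : Rel Unit IV is classical for (δ_Z, ε_Z) if and only if φ = z₀ or φ = z₁. -/
namespace ToyQuantumCategories

/-- Relational composition in categorical order: `RelComp S R` is `S ∘ R`,
first apply `R : A → B`, then `S : B → C`. -/
def RelComp {A B C : Type*} (S : Rel B C) (R : Rel A B) : Rel A C :=
  fun a c => ∃ b, R a b ∧ S b c

/-- The dagger (relational converse). -/
def RelDagger {A B : Type*} (R : Rel A B) : Rel B A :=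
  fun b a => R a b

/-- The parallel (monoidal) product of two relations. -/
def RelProd {A₁ A₂ B₁ B₂ : Type*} (R₁ : Rel A₁ B₁) (R₂ : Rel A₂ B₂) :
    Rel (A₁ × A₂) (B₁ × B₂) :=
  fun p q => R₁ p.1 q.1 ∧ R₂ p.2 q.2

/-- The identity relation. -/
def RelId (A : Type*) : Rel A A := fun a b => a = b

/-- The graph of the exchange bijection `A × B ≃ B × A`. -/
def RelSwap (A B : Type*) : Rel (A × B) (B × A) := fun p q => q = (p.2, p.1)

/-- The graph of a function. -/
def Graph {A B : Type*} (f : A → B) : Rel A B := fun a b => b = f a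

/-- A basis structure (dagger special commutative Frobenius comonoid):
coassociative (up to the canonical reassociation bijection), cocommutative,
counital (up to the canonical bijection `Unit × A ≅ A`), isometric, and
satisfying the Frobenius identity `δ ∘ δ† = (δ† ⊗ id) ∘ (id ⊗ δ)`
(up to the canonical reassociation bijection). -/
structure IsBasisStructure {A : Type*} (δ : Rel A (A × A)) (ε : Rel A Unit) : Prop where
  coassoc : ∀ (a x y z : A),
    RelComp (RelProd δ (RelId A)) δ a ((x, y), z) ↔
      RelComp (RelProd (RelId A) δ) δ a (x, (y, z))
  cocomm : RelComp (RelSwap A A) δ = δ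
  counit : ∀ (a b : A), RelComp (RelProd ε (RelId A)) δ a ((), b) ↔ a = b
  isometry : RelComp (RelDagger δ) δ = RelId A
  frobenius : ∀ (a b c d : A),
    RelComp δ (RelDagger δ) (a, b) (c, d) ↔ ∃ y, δ b (y, d) ∧ δ c (a, y)

/-- A state `φ : I → A` is classical for `(δ, ε)` when `δ ∘ φ = φ ⊗ φ`
(up to the canonical bijection `Unit ≅ Unit × Unit`) and `ε ∘ φ` is the
identity relation on the tensor unit. -/
def IsClassical {A : Type*} (δ : Rel A (A × A)) (ε : Rel A Unit) (φ : Rel Unit A) : Prop :=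
  (∀ (a b : A), RelComp δ φ () (a, b) ↔ RelProd φ φ ((), ()) (a, b)) ∧
    RelComp ε φ = RelId Unit

/-- `Lam δ φ = δ† ∘ (φ ⊗ id_A)` (up to the canonical bijection `Unit × A ≅ A`):
it relates `a` to `b` iff there is `c` with `φ` relating `⋆` to `c` and `δ`
relating `b` to `(c, a)`. -/
def Lam {A : Type*} (δ : Rel A (A × A)) (φ : Rel Unit A) : Rel A A :=
  fun a b => ∃ c, φ () c ∧ δ b (c, a)

/-- A state `φ : I → A` is unbiased for `δ` when `Lam δ φ` is unitary. -/
def IsUnbiased {A : Type*} (δ : Rel A (A × A)) (φ : Rel Unit A) : Prop :=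
  RelComp (Lam δ φ) (RelDagger (Lam δ φ)) = RelId A ∧
    RelComp (RelDagger (Lam δ φ)) (Lam δ φ) = RelId A

/-- The four-element set of Spekkens's toy theory; its elements `0, 1, 2, 3`
stand for the elements written `1, 2, 3, 4` in the paper. -/
abbrev IV := Fin 4

/-- `δ_Z` on `IV`: `1 ∼ (1,1),(2,2)`; `2 ∼ (1,2),(2,1)`; `3 ∼ (3,3),(4,4)`;
`4 ∼ (3,4),(4,3)` (written here with elements `0,1,2,3` for `1,2,3,4`). -/
def δZ : Rel IV (IV × IV) := fun i p =>
  (i = 0 ∧ (p = (0, 0) ∨ p = (1, 1))) ∨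
  (i = 1 ∧ (p = (0, 1) ∨ p = (1, 0))) ∨
  (i = 2 ∧ (p = (2, 2) ∨ p = (3, 3))) ∨
  (i = 3 ∧ (p = (2, 3) ∨ p = (3, 2)))

/-- `ε_Z` on `IV`: relates exactly the elements written `1` and `3`
(here `0` and `2`) to `⋆`. -/
def εZ : Rel IV Unit := fun i _ => i = 0 ∨ i = 2

/-- The state `z₀`: `⋆ ∼ {1, 2}` (here `{0, 1}`). -/
def z₀ : Rel Unit IV := fun _ j => j = 0 ∨ j = 1

/-- The state `z₁`: `⋆ ∼ {3, 4}` (here `{2, 3}`). -/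
def z₁ : Rel Unit IV := fun _ j => j = 2 ∨ j = 3

/-- The state `x₀`: `⋆ ∼ {1, 3}` (here `{0, 2}`). -/
def x₀ : Rel Unit IV := fun _ j => j = 0 ∨ j = 2

/-- The state `x₁`: `⋆ ∼ {2, 4}` (here `{1, 3}`). -/
def x₁ : Rel Unit IV := fun _ j => j = 1 ∨ j = 3

/-- The state `y₀`: `⋆ ∼ {1, 4}` (here `{0, 3}`). -/
def y₀ : Rel Unit IV := fun _ j => j = 0 ∨ j = 3

/-- The state `y₁`: `⋆ ∼ {2, 3}` (here `{1, 2}`). -/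
def y₁ : Rel Unit IV := fun _ j => j = 1 ∨ j = 2

/-- the classical states for `(δ_Z, ε_Z)` on `IV` are exactly
`z₀` and `z₁`. -/
theorem classical_for_Z_IV :
    ∀ φ : Rel Unit IV, IsClassical δZ εZ φ ↔ (φ = z₀ ∨ φ = z₁) := by
  intro φ
  have key : ∀ ψ : Rel Unit IV, φ = ψ ↔
      ((φ () 0 ↔ ψ () 0) ∧ (φ () 1 ↔ ψ () 1) ∧ (φ () 2 ↔ ψ () 2) ∧ (φ () 3 ↔ ψ () 3)) := by
    intro ψ
    constructor
    · rintro rfl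
      simp
    · rintro ⟨h0, h1, h2, h3⟩
      funext u j
      cases u
      fin_cases j
      · exact propext h0
      · exact propext h1
      · exact propext h2
      · exact propext h3
  have hε : RelComp εZ φ = RelId Unit ↔ (φ () 0 ∨ φ () 2) := by
    constructor
    · intro h
      have h1 : RelComp εZ φ () () := by rw [h]; rfl
      obtain ⟨b, hb, rfl | rfl⟩ := h1
      · exact Or.inl hb
      · exact Or.inr hb
    · intro h
      funext u v
      apply propext
      refine ⟨fun _ => rfl, fun _ => ?_⟩
      rcases h with h | h
      · exact ⟨0, h, Or.inl rfl⟩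
      · exact ⟨2, h, Or.inr rfl⟩
  unfold IsClassical
  rw [hε, key, key]
  simp only [RelComp, RelProd, δZ, z₀, z₁, Fin.forall_fin_succ, Fin.exists_fin_succ]
  generalize φ () = f
  by_cases h0 : f 0 <;> by_cases h1 : f 1 <;> by_cases h2 : f 2 <;> by_cases h3 : f 3 <;>
    simp [h0, h1, h2, h3]

end ToyQuantumCategories
end

section
/- For the basis structure (δ_Z, ε_Z) on IV = Fin 4 in FRel: a state φ : Rel Unit IV is unbiased for (δ_Z, ε_Z) if and only if φ ∈ {x₀, x₁, y₀, y₁}. -/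
namespace ToyQuantumCategories

/-- the unbiased states for `(δ_Z, ε_Z)` on `IV` are exactly
`x₀`, `x₁`, `y₀`, `y₁`. -/
theorem unbiased_for_Z_IV :
    ∀ φ : Rel Unit IV, IsUnbiased δZ φ ↔ (φ = x₀ ∨ φ = x₁ ∨ φ = y₀ ∨ φ = y₁) := by
  intro φ
  have key : ∀ R S : Rel IV IV, R = S ↔ ∀ a b, (R a b ↔ S a b) := fun R S =>
    ⟨fun h a b => by rw [h], fun h => by funext a b; exact propext (h a b)⟩
  have key' : ∀ R S : Rel Unit IV, R = S ↔ ∀ b, (R () b ↔ S () b) := fun R S =>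
    ⟨fun h b => by rw [h], fun h => by funext a b; exact propext (h b)⟩
  unfold IsUnbiased
  simp only [key, key', RelComp, RelDagger, RelId, Lam, δZ, x₀, x₁, y₀, y₁]
  by_cases h0 : φ () 0 <;> by_cases h1 : φ () 1 <;> by_cases h2 : φ () 2 <;>
    by_cases h3 : φ () 3 <;>
    simp [Fin.forall_fin_succ, Fin.exists_fin_succ, h0, h1, h2, h3]

end ToyQuantumCategories
end

section
/- In FRel let σ₂₃ be the graph of the transposition of IV = Fin 4 exchanging 2 and 3, and set δ_X := (σ₂₃ ⊗ σ₂₃) ∘ δ_Z ∘ σ₂₃ and ε_X := z₀†. Then (δ_X, ε_X) is a basis structure on IV, and a state φ : Rel Unit IV is classical for (δ_X, ε_X) if and only if φ = x₀ or φ = x₁. -/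
namespace ToyQuantumCategories

/-- The graph of the transposition of `IV` exchanging the elements written
`2` and `3` (here `1` and `2`). -/
def σ₂₃ : Rel IV IV := Graph (Equiv.swap (1 : IV) 2)

/-- `δ_X := (σ₂₃ ⊗ σ₂₃) ∘ δ_Z ∘ σ₂₃`. -/
def δX : Rel IV (IV × IV) := RelComp (RelProd σ₂₃ σ₂₃) (RelComp δZ σ₂₃)

/-- `ε_X := z₀†`. -/
def εX : Rel IV Unit := RelDagger z₀

instance decidableDeltaZ (i : IV) (p : IV × IV) : Decidable (δZ i p) := by
  unfold δZ
  infer_instance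

/-- `δX` as a Boolean table: addition on the two-element groups `{0,2}` and `{1,3}`. -/
def tableX (i a b : IV) : Bool := decide (
    (i = 0 ∧ (a = 0 ∧ b = 0 ∨ a = 2 ∧ b = 2)) ∨ (i = 2 ∧ (a = 0 ∧ b = 2 ∨ a = 2 ∧ b = 0)) ∨
    (i = 1 ∧ (a = 1 ∧ b = 1 ∨ a = 3 ∧ b = 3)) ∨ (i = 3 ∧ (a = 1 ∧ b = 3 ∨ a = 3 ∧ b = 1)))

theorem deltaX_iff (i a b : IV) : δX i (a, b) ↔ tableX i a b = true := by
  have h : δX i (a, b) ↔ δZ (Equiv.swap (1 : IV) 2 i)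
      (Equiv.swap (1 : IV) 2 a, Equiv.swap (1 : IV) 2 b) := by
    constructor
    · rintro ⟨⟨c, d⟩, ⟨_, rfl, h⟩, h1, h2⟩
      simp only [σ₂₃, Graph] at h1 h2
      simpa [h1, h2] using h
    · intro h
      exact ⟨_, ⟨_, rfl, h⟩, by simp [σ₂₃, Graph], by simp [σ₂₃, Graph]⟩
  rw [h]
  clear h
  revert i a b
  decide

/-- `(δ_X, ε_X)` is a basis structure on `IV` whose classical
states are exactly `x₀` and `x₁`. -/
theorem deltaX_basis_structure_and_classical :
    IsBasisStructure δX εX ∧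
    (∀ φ : Rel Unit IV, IsClassical δX εX φ ↔ (φ = x₀ ∨ φ = x₁)) := by
  refine ⟨⟨?_, ?_, ?_, ?_, ?_⟩, ?_⟩
  · simp only [RelComp, RelProd, RelId, Prod.exists, deltaX_iff]
    decide
  · funext a ⟨b, c⟩
    apply propext
    simp only [RelComp, RelSwap, Prod.exists, deltaX_iff]
    revert a b c
    decide
  · simp only [RelComp, RelProd, RelId, Prod.exists, deltaX_iff, εX, RelDagger, z₀]
    decide
  · funext a b
    apply propext
    simp only [RelComp, RelDagger, RelId, Prod.exists, deltaX_iff]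
    revert a b
    decide
  · simp only [RelComp, RelDagger, deltaX_iff]
    decide
  · intro φ
    have key : ∀ ψ : Rel Unit IV, φ = ψ ↔ ∀ j, (φ () j ↔ ψ () j) := fun ψ =>
      ⟨fun h j => by rw [h], fun h => by funext u j; exact propext (h j)⟩
    have key2 : RelComp εX φ = RelId Unit ↔ (φ () 0 ∨ φ () 1) := by
      constructor
      · intro h
        have h1 : RelComp εX φ () () := by rw [h]; rfl
        obtain ⟨b, hb, rfl | rfl⟩ := h1
        · exact Or.inl hb
        · exact Or.inr hb
      · intro h
        funext u v
        apply propext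
        refine ⟨fun _ => rfl, fun _ => ?_⟩
        rcases h with h | h
        · exact ⟨0, h, Or.inl rfl⟩
        · exact ⟨1, h, Or.inr rfl⟩
    rw [IsClassical, key2, key, key]
    simp only [RelComp, RelProd, deltaX_iff, tableX, x₀, x₁, Fin.forall_fin_succ, Fin.exists_fin_succ]
    by_cases h0 : φ () 0 <;> by_cases h1 : φ () 1 <;> by_cases h2 : φ () 2 <;>
      by_cases h3 : φ () 3 <;> simp [h0, h1, h2, h3]

end ToyQuantumCategories
end

section
/- In FRel let σ₂₄ be the graph of the transposition of IV = Fin 4 exchanging 2 and 4, and set δ_Y := (σ₂₄ ⊗ σ₂₄) ∘ δ_Z ∘ σ₂₄ and ε_Y := x₀†. Then (δ_Y, ε_Y) is a basis structure on IV, and a state φ : Rel Unit IV is classical for (δ_Y, ε_Y) if and only if φ = y₀ or φ = y₁. -/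
namespace ToyQuantumCategories

/-- The graph of the transposition of `IV` exchanging the elements written
`2` and `4` (here `1` and `3`). -/
def σ₂₄ : Rel IV IV := Graph (Equiv.swap (1 : IV) 3)

/-- `δ_Y := (σ₂₄ ⊗ σ₂₄) ∘ δ_Z ∘ σ₂₄`. -/
def δY : Rel IV (IV × IV) := RelComp (RelProd σ₂₄ σ₂₄) (RelComp δZ σ₂₄)

/-- `ε_Y := x₀†`. -/
def εY : Rel IV Unit := RelDagger x₀

instance decδZ (i : IV) (p : IV × IV) : Decidable (δZ i p) := by
  unfold δZ
  infer_instance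

/-- Boolean table of `δ_Y`. -/
def tabY (i a b : IV) : Bool :=
  decide (δZ (Equiv.swap (1 : IV) 3 i) (Equiv.swap (1 : IV) 3 a, Equiv.swap (1 : IV) 3 b))

theorem δY_iff (i a b : IV) : δY i (a, b) ↔ tabY i a b = true := by
  simp only [tabY, decide_eq_true_eq, δY, RelComp, RelProd, σ₂₄, Graph]
  constructor
  · rintro ⟨⟨c, d⟩, ⟨e, rfl, h⟩, rfl, rfl⟩
    simpa using h
  · intro h
    exact ⟨_, ⟨_, rfl, h⟩, by simp, by simp⟩

theorem tabY_eq : ∀ i a b : IV, tabY i a b = decide (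
    ((i = 0 ∧ ((a = 0 ∧ b = 0) ∨ (a = 3 ∧ b = 3))) ∨
     (i = 3 ∧ ((a = 0 ∧ b = 3) ∨ (a = 3 ∧ b = 0))) ∨
     (i = 2 ∧ ((a = 2 ∧ b = 2) ∨ (a = 1 ∧ b = 1))) ∨
     (i = 1 ∧ ((a = 2 ∧ b = 1) ∨ (a = 1 ∧ b = 2))))) := by
  decide

/-- `(δ_Y, ε_Y)` is a basis structure on `IV` whose classical
states are exactly `y₀` and `y₁`. -/
theorem deltaY_basis_structure_and_classical :
    IsBasisStructure δY εY ∧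
    (∀ φ : Rel Unit IV, IsClassical δY εY φ ↔ (φ = y₀ ∨ φ = y₁)) := by
  refine ⟨⟨?_, ?_, ?_, ?_, ?_⟩, ?_⟩
  · simp only [RelComp, RelProd, RelId, Prod.exists, δY_iff]
    decide
  · funext i p
    obtain ⟨a, b⟩ := p
    simp only [RelComp, RelSwap, Prod.exists, δY_iff, eq_iff_iff]
    revert i a b
    decide
  · simp only [RelComp, RelProd, RelId, Prod.exists, δY_iff, εY, RelDagger, x₀]
    decide
  · funext i j
    simp only [RelComp, RelDagger, RelId, Prod.exists, δY_iff, eq_iff_iff]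
    revert i j
    decide
  · simp only [RelComp, RelDagger, δY_iff]
    decide
  · intro φ
    have key : ∀ ψ : Rel Unit IV, φ = ψ ↔ ∀ j, φ () j ↔ ψ () j := by
      intro ψ
      constructor
      · rintro rfl j
        rfl
      · intro h
        funext u j
        exact propext (h j)
    have key2 : RelComp εY φ = RelId Unit ↔ ∃ b, φ () b ∧ (b = 0 ∨ b = 2) := by
      constructor
      · intro h
        have h1 : RelComp εY φ () () := by rw [h]; rfl
        exact h1
      · intro h
        funext u v
        exact propext ⟨fun _ => rfl, fun _ => h⟩
    rw [key, key, IsClassical, key2]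
    simp only [RelComp, RelProd, δY_iff, tabY_eq, decide_eq_true_eq, y₀, y₁]
    generalize φ () = f
    simp only [Fin.forall_fin_succ, Fin.exists_fin_succ]
    by_cases h0 : f 0 <;> by_cases h1 : f 1 <;> by_cases h2 : f 2 <;> by_cases h3 : f 3 <;>
      simp_all [Fin.forall_fin_succ, Fin.exists_fin_succ]

end ToyQuantumCategories
end

section
/- The basis structures (δ_Z, ε_Z) and (δ_X, ε_X := z₀†) on IV = Fin 4 in FRel are complementary in the sense of Definition 1.1 and satisfy the Hopf law: every state classical for (δ_X, ε_X) is unbiased for (δ_Z, ε_Z); every state classical for (δ_Z, ε_Z) is unbiased for (δ_X, ε_X); ε_X† is classical for (δ_Z, ε_Z); ε_Z† is classical for (δ_X, ε_X); and δ_X† ∘ δ_Z = ε_X† ∘ ε_Z as relations IV → IV. -/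
namespace ToyQuantumCategories

set_option synthInstance.maxHeartbeats 2000000 in
set_option synthInstance.maxSize 100000 in
set_option maxRecDepth 100000 in
/-- Explicit form of `δX`. -/
theorem δX_iff (i : IV) (p : IV × IV) : δX i p ↔
    ((i = 0 ∧ (p = (0, 0) ∨ p = (2, 2))) ∨
  (i = 2 ∧ (p = (0, 2) ∨ p = (2, 0))) ∨
  (i = 1 ∧ (p = (1, 1) ∨ p = (3, 3))) ∨
  (i = 3 ∧ (p = (1, 3) ∨ p = (3, 1)))) := by
  simp only [δX, δZ, σ₂₃, RelComp, RelProd, Graph, exists_eq_left]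
  revert i p
  decide

/-- Every state is the truth set of a Boolean function. -/
theorem state_eq (φ : Rel Unit IV) : ∃ f : IV → Bool, φ = fun _ j => f j = true := by
  classical
  exact ⟨fun j => decide (φ () j), by funext u j; simp⟩

set_option synthInstance.maxHeartbeats 2000000 in
set_option synthInstance.maxSize 100000 in
set_option maxRecDepth 100000 in
set_option maxHeartbeats 4000000 in
/-- `(δ_Z, ε_Z)` and `(δ_X, ε_X)` on `IV` are complementary and
satisfy the Hopf law `δ_X† ∘ δ_Z = ε_X† ∘ ε_Z`. -/
theorem Z_X_complementary_IV :
    (∀ φ : Rel Unit IV, IsClassical δX εX φ → IsUnbiased δZ φ) ∧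
    (∀ φ : Rel Unit IV, IsClassical δZ εZ φ → IsUnbiased δX φ) ∧
    IsClassical δZ εZ (RelDagger εX) ∧
    IsClassical δX εX (RelDagger εZ) ∧
    RelComp (RelDagger δX) δZ = RelComp (RelDagger εX) εZ := by
  refine ⟨?_, ?_, ?_, ?_, ?_⟩
  · intro φ
    obtain ⟨f, rfl⟩ := state_eq φ
    simp only [IsClassical, IsUnbiased, Lam, RelComp, RelDagger, RelProd, RelId, εX, z₀,
      funext_iff, eq_iff_iff, δX_iff, δZ]
    revert f
    decide
  · intro φ
    obtain ⟨f, rfl⟩ := state_eq φ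
    simp only [IsClassical, IsUnbiased, Lam, RelComp, RelDagger, RelProd, RelId, εZ,
      funext_iff, eq_iff_iff, δX_iff, δZ]
    revert f
    decide
  · simp only [IsClassical, RelComp, RelDagger, RelProd, RelId, εX, εZ, z₀,
      funext_iff, eq_iff_iff, δZ]
    decide
  · simp only [IsClassical, RelComp, RelDagger, RelProd, RelId, εX, εZ, z₀,
      funext_iff, eq_iff_iff, δX_iff]
    decide
  · simp only [RelComp, RelDagger, εX, εZ, z₀,
      funext_iff, eq_iff_iff, δX_iff, δZ]
    decide

end ToyQuantumCategories
end

section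
/- For every permutation π of IV = Fin 4, the transported comonoid ((π ⊗ π) ∘ δ_Z ∘ π⁻¹, ε_Z ∘ π⁻¹) is a basis structure whose classical states are exactly π∘z₀ and π∘z₁, and the unordered pair {π∘z₀, π∘z₁} equals one of the three pairs {z₀, z₁}, {x₀, x₁}, {y₀, y₁}; hence transforming the observable Z by permutations yields only the three observables Z, X, Y. -/
namespace ToyQuantumCategories

/-- The comultiplication `(π ⊗ π) ∘ δ_Z ∘ π⁻¹` obtained by transporting `δ_Z`
along a permutation `π` of `IV`. -/
def transDelta (π : Equiv.Perm IV) : Rel IV (IV × IV) :=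
  RelComp (RelProd (Graph ⇑π) (Graph ⇑π)) (RelComp δZ (Graph ⇑π⁻¹))

/-- The counit `ε_Z ∘ π⁻¹` obtained by transporting `ε_Z` along a permutation
`π` of `IV`. -/
def transEps (π : Equiv.Perm IV) : Rel IV Unit :=
  RelComp εZ (Graph ⇑π⁻¹)

theorem transDelta_iff (π : Equiv.Perm IV) (a b c : IV) :
    transDelta π a (b, c) ↔ δZ (π⁻¹ a) (π⁻¹ b, π⁻¹ c) := by
  unfold transDelta RelComp RelProd Graph
  constructor
  · rintro ⟨⟨p, q⟩, ⟨d, rfl, h⟩, rfl, rfl⟩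
    simpa using h
  · intro h
    exact ⟨(π⁻¹ b, π⁻¹ c), ⟨_, rfl, h⟩, by simp, by simp⟩

theorem transEps_iff (π : Equiv.Perm IV) (a : IV) (u : Unit) :
    transEps π a u ↔ εZ (π⁻¹ a) u := by
  unfold transEps RelComp Graph
  simp

theorem graphComp_iff (π : Equiv.Perm IV) (φ : Rel Unit IV) (u : Unit) (a : IV) :
    RelComp (Graph ⇑π) φ u a ↔ φ u (π⁻¹ a) := by
  unfold RelComp Graph
  constructor
  · rintro ⟨b, h, rfl⟩
    simpa using h
  · intro h
    exact ⟨_, h, by simp⟩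

instance (a b c : IV) : Decidable (δZ a (b, c)) := by unfold δZ; infer_instance

instance (a : IV) (u : Unit) : Decidable (εZ a u) := by unfold εZ; infer_instance

set_option maxRecDepth 100000 in
set_option maxHeartbeats 4000000 in
theorem Z_coassoc : ∀ a x y z : IV,
    (∃ b, δZ a (b, z) ∧ δZ b (x, y)) ↔ (∃ b, δZ a (x, b) ∧ δZ b (y, z)) := by decide

set_option maxRecDepth 100000 in
set_option maxHeartbeats 4000000 in
theorem Z_cocomm : ∀ a x y : IV, δZ a (x, y) ↔ δZ a (y, x) := by decide

set_option maxRecDepth 100000 in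
set_option maxHeartbeats 4000000 in
theorem Z_counit : ∀ a b : IV, (∃ c, δZ a (c, b) ∧ εZ c ()) ↔ a = b := by decide

set_option maxRecDepth 100000 in
set_option maxHeartbeats 4000000 in
theorem Z_isometry : ∀ a b : IV, (∃ x y, δZ a (x, y) ∧ δZ b (x, y)) ↔ a = b := by decide

set_option maxRecDepth 100000 in
set_option maxHeartbeats 4000000 in
theorem Z_frobenius : ∀ a b c d : IV,
    (∃ x, δZ x (a, b) ∧ δZ x (c, d)) ↔ ∃ y, δZ b (y, d) ∧ δZ c (a, y) := by decide

theorem exists_transport (π : Equiv.Perm IV) (P : IV → Prop) :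
    (∃ b, P (π⁻¹ b)) ↔ ∃ b, P b :=
  (π⁻¹).surjective.exists.symm

theorem trans_basis (π : Equiv.Perm IV) :
    IsBasisStructure (transDelta π) (transEps π) where
  coassoc a x y z := by
    simp only [RelComp, RelProd, RelId, Prod.exists, transDelta_iff]
    have h := ((exists_transport π fun b => δZ (π⁻¹ a) (b, π⁻¹ z) ∧ δZ b (π⁻¹ x, π⁻¹ y)).trans
      (Z_coassoc (π⁻¹ a) (π⁻¹ x) (π⁻¹ y) (π⁻¹ z))).trans
      (exists_transport π fun b => δZ (π⁻¹ a) (π⁻¹ x, b) ∧ δZ b (π⁻¹ y, π⁻¹ z)).symm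
    constructor
    · rintro ⟨b, c, h1, h2, rfl⟩
      obtain ⟨d, h3, h4⟩ := h.1 ⟨b, h1, h2⟩
      exact ⟨x, d, h3, rfl, h4⟩
    · rintro ⟨b, c, h1, rfl, h2⟩
      obtain ⟨d, h3, h4⟩ := h.2 ⟨c, h1, h2⟩
      exact ⟨d, z, h3, h4, rfl⟩
  cocomm := by
    funext a p
    obtain ⟨x, y⟩ := p
    apply propext
    rw [transDelta_iff, Z_cocomm, ← transDelta_iff]
    constructor
    · rintro ⟨⟨c, d⟩, h1, h2⟩
      obtain ⟨rfl, rfl⟩ := Prod.mk.inj h2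
      exact h1
    · intro h
      exact ⟨(y, x), h, rfl⟩
  counit a b := by
    simp only [RelComp, RelProd, RelId, Prod.exists, transDelta_iff, transEps_iff]
    have h := Z_counit (π⁻¹ a) (π⁻¹ b)
    rw [← exists_transport π, (π⁻¹).injective.eq_iff] at h
    rw [← h]
    constructor
    · rintro ⟨c, d, h1, h2, rfl⟩
      exact ⟨c, h1, h2⟩
    · rintro ⟨c, h1, h2⟩
      exact ⟨c, b, h1, h2, rfl⟩
  isometry := by
    funext a b
    apply propext
    simp only [RelComp, RelDagger, RelId, Prod.exists, transDelta_iff]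
    have h := Z_isometry (π⁻¹ a) (π⁻¹ b)
    rw [(π⁻¹).injective.eq_iff] at h
    rw [← h]
    refine Iff.trans ?_ (exists_transport π fun x =>
      ∃ y, δZ (π⁻¹ a) (x, y) ∧ δZ (π⁻¹ b) (x, y))
    refine exists_congr fun x => ?_
    exact exists_transport π fun y => δZ (π⁻¹ a) (π⁻¹ x, y) ∧ δZ (π⁻¹ b) (π⁻¹ x, y)
  frobenius a b c d := by
    simp only [RelComp, RelDagger, transDelta_iff]
    exact ((exists_transport π fun x => δZ x (π⁻¹ a, π⁻¹ b) ∧ δZ x (π⁻¹ c, π⁻¹ d)).trans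
      (Z_frobenius (π⁻¹ a) (π⁻¹ b) (π⁻¹ c) (π⁻¹ d))).trans
      (exists_transport π fun y => δZ (π⁻¹ b) (y, π⁻¹ d) ∧ δZ (π⁻¹ c) (π⁻¹ a, y)).symm

set_option maxRecDepth 100000 in
set_option maxHeartbeats 4000000 in
theorem Z_classical_bool : ∀ f : IV → Bool,
    ((∀ a b : IV, (∃ c, f c = true ∧ δZ c (a, b)) ↔ (f a = true ∧ f b = true)) ∧
      (∃ c, f c = true ∧ εZ c ())) ↔
    ((∀ a, f a = true ↔ (a = 0 ∨ a = 1)) ∨ (∀ a, f a = true ↔ (a = 2 ∨ a = 3))) := by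
  decide

set_option maxRecDepth 100000 in
set_option maxHeartbeats 4000000 in
theorem Z_classical (f : IV → Prop) :
    ((∀ a b : IV, (∃ c, f c ∧ δZ c (a, b)) ↔ (f a ∧ f b)) ∧ (∃ c, f c ∧ εZ c ())) ↔
    ((∀ a, f a ↔ (a = 0 ∨ a = 1)) ∨ (∀ a, f a ↔ (a = 2 ∨ a = 3))) := by
  classical
  simpa using Z_classical_bool fun a => decide (f a)

theorem state_eq_iff (φ ψ : Rel Unit IV) (π : Equiv.Perm IV) :
    φ = RelComp (Graph ⇑π) ψ ↔ ∀ a, φ () (π a) ↔ ψ () a := by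
  constructor
  · rintro rfl a
    simp [graphComp_iff]
  · intro h
    funext u a
    apply propext
    rw [graphComp_iff, ← h]
    simp

theorem trans_classical (π : Equiv.Perm IV) (φ : Rel Unit IV) :
    IsClassical (transDelta π) (transEps π) φ ↔
      (φ = RelComp (Graph ⇑π) z₀ ∨ φ = RelComp (Graph ⇑π) z₁) := by
  rw [state_eq_iff, state_eq_iff]
  refine Iff.trans ?_ (Z_classical fun a => φ () (π a))
  refine and_congr ?_ ?_
  · rw [π.surjective.forall]
    refine forall_congr' fun a => ?_
    rw [π.surjective.forall]
    refine forall_congr' fun b => ?_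
    simp only [RelComp, RelProd, transDelta_iff]
    rw [π.surjective.exists]
    simp
  · constructor
    · intro h
      have h1 : RelComp (transEps π) φ () () := by rw [h]; rfl
      obtain ⟨c, h2, h3⟩ := h1
      rw [transEps_iff] at h3
      exact ⟨π⁻¹ c, by simpa using h2, h3⟩
    · rintro ⟨c, h2, h3⟩
      funext u v
      apply propext
      refine ⟨fun _ => rfl, fun _ => ⟨π c, h2, ?_⟩⟩
      rw [transEps_iff]
      simpa using h3

set_option maxRecDepth 100000 in
set_option maxHeartbeats 4000000 in
set_option synthInstance.maxSize 100000 in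
set_option synthInstance.maxHeartbeats 0 in
theorem pairs_aux : ∀ π : Equiv.Perm IV,
    ((∀ j, (π⁻¹ j = 0 ∨ π⁻¹ j = 1) ↔ (j = 0 ∨ j = 1)) ∧ (∀ j, (π⁻¹ j = 2 ∨ π⁻¹ j = 3) ↔ (j = 2 ∨ j = 3))) ∨
    ((∀ j, (π⁻¹ j = 0 ∨ π⁻¹ j = 1) ↔ (j = 2 ∨ j = 3)) ∧ (∀ j, (π⁻¹ j = 2 ∨ π⁻¹ j = 3) ↔ (j = 0 ∨ j = 1))) ∨
    ((∀ j, (π⁻¹ j = 0 ∨ π⁻¹ j = 1) ↔ (j = 0 ∨ j = 2)) ∧ (∀ j, (π⁻¹ j = 2 ∨ π⁻¹ j = 3) ↔ (j = 1 ∨ j = 3))) ∨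
    ((∀ j, (π⁻¹ j = 0 ∨ π⁻¹ j = 1) ↔ (j = 1 ∨ j = 3)) ∧ (∀ j, (π⁻¹ j = 2 ∨ π⁻¹ j = 3) ↔ (j = 0 ∨ j = 2))) ∨
    ((∀ j, (π⁻¹ j = 0 ∨ π⁻¹ j = 1) ↔ (j = 0 ∨ j = 3)) ∧ (∀ j, (π⁻¹ j = 2 ∨ π⁻¹ j = 3) ↔ (j = 1 ∨ j = 2))) ∨
    ((∀ j, (π⁻¹ j = 0 ∨ π⁻¹ j = 1) ↔ (j = 1 ∨ j = 2)) ∧ (∀ j, (π⁻¹ j = 2 ∨ π⁻¹ j = 3) ↔ (j = 0 ∨ j = 3))) := by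
  decide

theorem comp_eq (π : Equiv.Perm IV) (ψ χ : Rel Unit IV)
    (h : ∀ j, ψ () (π⁻¹ j) ↔ χ () j) : RelComp (Graph ⇑π) ψ = χ := by
  funext u j
  exact propext ((graphComp_iff π ψ u j).trans (h j))

/-- for every permutation `π` of `IV`, the transported comonoid
is a basis structure with classical states exactly `π ∘ z₀` and `π ∘ z₁`, and
the unordered pair `{π ∘ z₀, π ∘ z₁}` is one of `{z₀, z₁}`, `{x₀, x₁}`,
`{y₀, y₁}`: permuting the observable `Z` only yields `Z`, `X`, `Y`. -/
theorem transported_observables :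
    ∀ π : Equiv.Perm IV,
      IsBasisStructure (transDelta π) (transEps π) ∧
      (∀ φ : Rel Unit IV, IsClassical (transDelta π) (transEps π) φ ↔
        (φ = RelComp (Graph ⇑π) z₀ ∨ φ = RelComp (Graph ⇑π) z₁)) ∧
      (({RelComp (Graph ⇑π) z₀, RelComp (Graph ⇑π) z₁} : Set (Rel Unit IV)) = {z₀, z₁} ∨
       ({RelComp (Graph ⇑π) z₀, RelComp (Graph ⇑π) z₁} : Set (Rel Unit IV)) = {x₀, x₁} ∨
       ({RelComp (Graph ⇑π) z₀, RelComp (Graph ⇑π) z₁} : Set (Rel Unit IV)) = {y₀, y₁}) := by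
  intro π
  refine ⟨trans_basis π, trans_classical π, ?_⟩
  rcases pairs_aux π with h | h | h | h | h | h
  · left
    rw [comp_eq π z₀ z₀ h.1, comp_eq π z₁ z₁ h.2]
  · left
    rw [comp_eq π z₀ z₁ h.1, comp_eq π z₁ z₀ h.2, Set.pair_comm]
  · right; left
    rw [comp_eq π z₀ x₀ h.1, comp_eq π z₁ x₁ h.2]
  · right; left
    rw [comp_eq π z₀ x₁ h.1, comp_eq π z₁ x₀ h.2, Set.pair_comm]
  · right; right
    rw [comp_eq π z₀ y₀ h.1, comp_eq π z₁ y₁ h.2]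
  · right; right
    rw [comp_eq π z₀ y₁ h.1, comp_eq π z₁ y₀ h.2, Set.pair_comm]

end ToyQuantumCategories
end
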